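/- Let T₁₁ (p₁ × p₁) and T₂₂ (p₂ × p₂) be real matrices with all complex eigenvalues having negative real part, T₁₂ a p₁ × p₂ real matrix, and η a row vector in ℝ^{p₁}. Let d ∈ ℕ, let e_{i1}, e_{i2} > 0 and y_{i1}, y_{i2} ∈ ℕ₀ for i = 1,…,d, and write y_{•j} = Σ_i y_{ij}, e_{•j} = Σ_i e_{ij} for j = 1,2. Then ∫_0^∞ ∫_0^∞ ∏_{j=1}^2 ∏_{i=1}^d ((θ_j e_{ij})^{y_{ij}}/y_{ij}!) e^{-θ_j e_{ij}} · η e^{T₁₁ θ₁} T₁₂ e^{T₂₂ θ₂} (−T₂₂) 𝟙 dθ₁ dθ₂ = (∏_{i=1}^d (e_{i1})^{y_{i1}} (e_{i2})^{y_{i2}} / (y_{i1}! y_{i2}!)) · (y_{•1}! y_{•2}!) · η (e_{•1} I − T₁₁)^{-(y_{•1}+1)} T₁₂ (e_{•2} I − T₂₂)^{-(y_{•2}+1)} (−T₂₂) 𝟙. -/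

import Mathlib

open MeasureTheory Real Set Matrix Finset

/-- The matrix exponential `e^M = Σ_{r ≥ 0} M^r / r!`. -/
noncomputable def matExp {p : ℕ} (M : Matrix (Fin p) (Fin p) ℝ) :
    Matrix (Fin p) (Fin p) ℝ :=
  ∑' r : ℕ, ((r.factorial : ℝ)⁻¹) • M ^ r

section Semigroup

open Asymptotics Filter

theorem exp_algebraMap_add {A : Type*} [NormedRing A] [NormedAlgebra ℂ A] [CompleteSpace A]
    (z : ℂ) (x : A) :
    NormedSpace.exp (algebraMap ℂ A z + x) = Complex.exp z • NormedSpace.exp x := by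
  let _ : NormedAlgebra ℚ A := NormedAlgebra.restrictScalars ℚ ℂ A
  rw [NormedSpace.exp_add_of_commute (Algebra.commute_algebraMap_left z x),
    ← NormedSpace.algebraMap_exp_comm, ← Complex.exp_eq_exp_ℂ, ← Algebra.smul_def]

variable {A : Type*} [NormedRing A] [NormedAlgebra ℝ A]

theorem pow_mul_exp_smul_exp_isBigO (T : A)
    (hT : ∀ b > 0, (fun t : ℝ => NormedSpace.exp (t • T)) =O[atTop] fun t => Real.exp (b * t)) {e : ℝ} (he : 0 < e) (n : ℕ) :
    (fun t : ℝ => (t ^ n * Real.exp (-(e * t))) • NormedSpace.exp (t • T))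
      =O[atTop] fun t => Real.exp (-(e / 4) * t) := by
  have h1 := isLittleO_pow_exp_pos_mul_atTop n (b := e / 4) (by positivity) |>.isBigO
  have h2 := hT (e / 2) (by positivity)
  refine ((h1.mul (isBigO_refl (fun t => Real.exp (-(e * t))) atTop)).smul h2).congr_right ?_
  intro t
  simp only [smul_eq_mul, ← Real.exp_add]
  congr 1
  ring

variable [CompleteSpace A]

theorem integrableOn_pow_mul_exp_smul_exp (T : A)
    (hT : ∀ b > 0, (fun t : ℝ => NormedSpace.exp (t • T)) =O[atTop] fun t => Real.exp (b * t)) {e : ℝ} (he : 0 < e) (n : ℕ) :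
    IntegrableOn (fun t : ℝ => (t ^ n * Real.exp (-(e * t))) • NormedSpace.exp (t • T))
      (Set.Ioi 0) := by
  let _ : NormedAlgebra ℚ A := NormedAlgebra.restrictScalars ℚ ℝ A
  have hc : Continuous
      fun t : ℝ => (t ^ n * Real.exp (-(e * t))) • NormedSpace.exp (t • T) :=
    (by fun_prop : Continuous fun t : ℝ => t ^ n * Real.exp (-(e * t))).smul
      (NormedSpace.exp_continuous.comp (by fun_prop))
  refine (integrable_norm_iff hc.aestronglyMeasurable).1 ?_
  exact integrable_of_isBigO_exp_neg (b := e / 4) (by positivity) hc.norm.continuousOn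
    (pow_mul_exp_smul_exp_isBigO T hT he n).norm_left

theorem hasDerivAt_pow_mul_exp_smul_exp (T : A) (e : ℝ) (n : ℕ)
    (t : ℝ) :
    HasDerivAt (fun t : ℝ => (t ^ n * Real.exp (-(e * t))) • NormedSpace.exp (t • T))
      ((n : ℝ) • ((t ^ (n - 1) * Real.exp (-(e * t))) • NormedSpace.exp (t • T))
        - (e • (1 : A) - T)
          * ((t ^ n * Real.exp (-(e * t))) • NormedSpace.exp (t • T))) t := by
  have h1 : HasDerivAt (fun t : ℝ => Real.exp (-(e * t))) (Real.exp (-(e * t)) * (-(e * 1))) t :=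
    ((hasDerivAt_id t).const_mul e).neg.exp
  have h2 := ((hasDerivAt_pow n t).mul h1).smul (hasDerivAt_exp_smul_const' (𝕂 := ℝ) T t)
  refine h2.congr_deriv ?_
  simp only [sub_mul, smul_mul_assoc, one_mul, mul_smul_comm, Pi.mul_apply]
  generalize NormedSpace.exp (t • T) = X
  generalize T * X = Y
  module

/-- Operator-valued Gamma integral, in the form of a relation not presupposing invertibility. -/
theorem pow_mul_integral_pow_mul_exp_smul_exp (T : A)
    (hT : ∀ b > 0, (fun t : ℝ => NormedSpace.exp (t • T)) =O[atTop] fun t => Real.exp (b * t)) {e : ℝ} (he : 0 < e) (n : ℕ) :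
    (e • (1 : A) - T) ^ (n + 1)
        * ∫ t in Set.Ioi (0 : ℝ), (t ^ n * Real.exp (-(e * t))) • NormedSpace.exp (t • T)
      = (n.factorial : ℝ) • 1 := by
  have hint := integrableOn_pow_mul_exp_smul_exp T hT he
  have hlim : ∀ m : ℕ, Tendsto
      (fun t : ℝ => (t ^ m * Real.exp (-(e * t))) • NormedSpace.exp (t • T)) atTop (nhds 0) := by
    intro m
    refine (pow_mul_exp_smul_exp_isBigO T hT he m).trans_tendsto ?_
    exact Real.tendsto_exp_atBot.comp (tendsto_id.const_mul_atTop_of_neg (by linarith))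
  have hmul : ∀ m : ℕ, (m : ℝ) • (∫ t in Set.Ioi (0 : ℝ),
          (t ^ (m - 1) * Real.exp (-(e * t))) • NormedSpace.exp (t • T))
        - (e • (1 : A) - T) * (∫ t in Set.Ioi (0 : ℝ),
          (t ^ m * Real.exp (-(e * t))) • NormedSpace.exp (t • T))
        = 0 - (0 ^ m : ℝ) • 1 := by
    intro m
    have h1 := (hint (m - 1)).fun_smul (m : ℝ)
    have h2 := (hint m).const_mul (e • (1 : A) - T)
    have key := integral_Ioi_of_hasDerivAt_of_tendsto' (a := (0 : ℝ))
      (fun t _ => hasDerivAt_pow_mul_exp_smul_exp T e m t) (h1.sub h2) (hlim m)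
    rw [integral_sub h1 h2, integral_smul, integral_const_mul_of_integrable (hint m)] at key
    simpa using key
  induction n with
  | zero =>
    have := hmul 0
    simp only [Nat.cast_zero, zero_smul, zero_sub, pow_zero, one_smul, neg_inj] at this
    simpa using this
  | succ n ih =>
    have h := hmul (n + 1)
    simp only [Nat.add_sub_cancel, zero_pow (Nat.succ_ne_zero n), zero_smul, sub_zero,
      sub_eq_zero] at h
    rw [pow_succ, mul_assoc, ← h, mul_smul_comm, ih, smul_smul, Nat.factorial_succ]
    push_cast
    rfl

theorem integral_pow_mul_exp_mul_clm_exp (T : A)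
    (hT : ∀ b > 0, (fun t : ℝ => NormedSpace.exp (t • T)) =O[atTop] fun t => Real.exp (b * t))
    {e : ℝ} (he : 0 < e) (n : ℕ) {R : A} (hR : R * (e • (1 : A) - T) = 1) (L : A →L[ℝ] ℝ) :
    ∫ t in Set.Ioi (0 : ℝ), t ^ n * Real.exp (-(e * t)) * L (NormedSpace.exp (t • T))
      = n.factorial * L (R ^ (n + 1)) := by
  have hI := pow_mul_integral_pow_mul_exp_smul_exp T hT he n
  have hRn : ∀ m : ℕ, R ^ m * (e • (1 : A) - T) ^ m = 1 := by
    intro m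
    induction m with
    | zero => simp
    | succ m ih => rw [pow_succ, pow_succ', mul_assoc, ← mul_assoc R, hR, one_mul, ih]
  have h := L.integral_comp_comm (integrableOn_pow_mul_exp_smul_exp T hT he n)
  have hI' := congrArg (R ^ (n + 1) * ·) hI
  simp only [← mul_assoc, hRn, one_mul, mul_smul_comm, mul_one] at hI'
  rw [hI'] at h
  simpa using h

end Semigroup

section MatrixSemigroup

open Asymptotics Filter
open scoped Matrix.Norms.Operator

theorem matExp_eq_exp {p : ℕ} (M : Matrix (Fin p) (Fin p) ℝ) :
    matExp M = NormedSpace.exp M := by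
  rw [matExp, NormedSpace.exp_eq_tsum ℝ]

/-- The exponential of a matrix, applied to a vector killed by a power of the matrix, is a
polynomial in the time parameter. -/
theorem exp_smul_mulVec_of_pow_mulVec_eq_zero {p : ℕ} (N : Matrix (Fin p) (Fin p) ℂ)
    (v : Fin p → ℂ) (k : ℕ) (hk : (N ^ k) *ᵥ v = 0) (t : ℂ) :
    NormedSpace.exp (t • N) *ᵥ v
      = ∑ r ∈ Finset.range k, (((r.factorial : ℂ)⁻¹) * t ^ r) • ((N ^ r) *ᵥ v) := by
  have hs := NormedSpace.exp_series_hasSum_exp' (𝕂 := ℂ) (t • N)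
  have hcont : Continuous fun X : Matrix (Fin p) (Fin p) ℂ => X *ᵥ v := by fun_prop
  have hs' := hs.map (Matrix.mulVec.addMonoidHomLeft v) hcont
  refine hs'.unique ?_
  have hterm : ∀ r, (Matrix.mulVec.addMonoidHomLeft v ∘
      fun n : ℕ => ((n.factorial : ℂ)⁻¹) • (t • N) ^ n) r
        = (((r.factorial : ℂ)⁻¹) * t ^ r) • ((N ^ r) *ᵥ v) := by
    intro r
    simp [Matrix.mulVec.addMonoidHomLeft, smul_pow, Matrix.smul_mulVec, smul_smul]
  rw [funext hterm]
  refine hasSum_sum_of_ne_finset_zero fun r hr => ?_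
  have hr' : k ≤ r := by simpa using hr
  rw [← Nat.sub_add_cancel hr', pow_add N, ← Matrix.mulVec_mulVec, hk, Matrix.mulVec_zero, smul_zero]

theorem exp_smul_mulVec_isBigO {p : ℕ} (M : Matrix (Fin p) (Fin p) ℂ)
    (hM : ∀ z ∈ spectrum ℂ M, z.re ≤ 0) {b : ℝ} (hb : 0 < b) (v : Fin p → ℂ) :
    (fun t : ℝ => NormedSpace.exp ((t : ℂ) • M) *ᵥ v) =O[atTop] fun t => Real.exp (b * t) := by
  have hv : v ∈ ⨆ μ, Module.End.maxGenEigenspace (Matrix.toLin' M) μ := by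
    rw [Module.End.iSup_maxGenEigenspace_eq_top]; trivial
  induction hv using Submodule.iSup_induction' with
  | zero => simpa only [Matrix.mulVec_zero] using isBigO_zero _ _
  | add x y _ _ hx hy => simpa only [Matrix.mulVec_add] using hx.add hy
  | mem μ x hx =>
    obtain ⟨k, hk⟩ := Module.End.mem_maxGenEigenspace _ _ _ |>.1 hx
    have hN : Matrix.toLin' M - μ • 1 = Matrix.toLin' (M - μ • 1) := by
      simp [Module.End.one_eq_id]
    rw [hN, ← Matrix.toLin'_pow, Matrix.toLin'_apply] at hk
    by_cases hμ : μ ∈ spectrum ℂ M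
    · have hexp : ∀ t : ℝ, NormedSpace.exp ((t : ℂ) • M) *ᵥ x = Complex.exp (t * μ) •
          ∑ r ∈ Finset.range k,
            (((r.factorial : ℂ)⁻¹) * (t : ℂ) ^ r) • (((M - μ • 1) ^ r) *ᵥ x) := by
        intro t
        rw [← exp_smul_mulVec_of_pow_mulVec_eq_zero _ _ _ hk]
        have h1 : (t : ℂ) • M = algebraMap ℂ (Matrix (Fin p) (Fin p) ℂ) (t * μ)
            + (t : ℂ) • (M - μ • 1) := by
          rw [Algebra.algebraMap_eq_smul_one, smul_sub, smul_smul]; abel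
        have h2 : NormedSpace.exp ((t : ℂ) • M)
            = Complex.exp (t * μ) • NormedSpace.exp ((t : ℂ) • (M - μ • 1)) := by
          rw [h1]; exact exp_algebraMap_add _ _
        rw [h2, Matrix.smul_mulVec]
      simp_rw [hexp]
      have h1 : (fun t : ℝ => Complex.exp (t * μ)) =O[atTop] fun _ : ℝ => (1 : ℝ) := by
        refine IsBigO.of_bound 1 ?_
        filter_upwards [eventually_ge_atTop 0] with t ht
        have : t * μ.re ≤ 0 := mul_nonpos_of_nonneg_of_nonpos ht (hM μ hμ)
        simpa [Complex.norm_exp] using this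
      have h2 : (fun t : ℝ => ∑ r ∈ Finset.range k,
            (((r.factorial : ℂ)⁻¹) * (t : ℂ) ^ r) • (((M - μ • 1) ^ r) *ᵥ x))
          =O[atTop] fun t => Real.exp (b * t) := by
        refine IsBigO.fun_sum fun r _ => ?_
        have h3 : (fun t : ℝ => ((r.factorial : ℂ)⁻¹) * (t : ℂ) ^ r)
            =O[atTop] fun t => Real.exp (b * t) := by
          refine IsBigO.const_mul_left ?_ _
          refine IsBigO.trans (IsBigO.of_norm_left ?_)
            (isLittleO_pow_exp_pos_mul_atTop r hb).isBigO
          simpa using (isBigO_refl (fun t : ℝ => t ^ r) atTop).norm_left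
        simpa only [smul_eq_mul, mul_one] using h3.smul (isBigO_const_const (((M - μ • 1) ^ r) *ᵥ x) (one_ne_zero (α := ℝ)) atTop)
      simpa using h1.smul h2
    · have hu : IsUnit ((M - μ • 1) ^ k) := by
        refine IsUnit.pow k ?_
        rw [spectrum.notMem_iff, Algebra.algebraMap_eq_smul_one] at hμ
        simpa using hμ.neg
      have hx0 : x = 0 :=
        Matrix.mulVec_injective_iff_isUnit.2 hu (by rw [hk, Matrix.mulVec_zero])
      simpa only [hx0, Matrix.mulVec_zero] using isBigO_zero _ _

theorem exp_smul_isBigO {p : ℕ} (T : Matrix (Fin p) (Fin p) ℝ)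
    (hT : ∀ z ∈ spectrum ℂ (T.map Complex.ofReal), z.re ≤ 0) {b : ℝ} (hb : 0 < b) :
    (fun t : ℝ => NormedSpace.exp (t • T)) =O[atTop] fun t => Real.exp (b * t) := by
  let L : (Fin p → Fin p → ℝ) →L[ℝ] Matrix (Fin p) (Fin p) ℝ :=
    LinearMap.toContinuousLinearMap (Matrix.ofLinearEquiv ℝ).toLinearMap
  have hL := L.isBigO_comp (fun t : ℝ => fun i j => NormedSpace.exp (t • T) i j) atTop
  refine IsBigO.trans hL (isBigO_pi.2 fun i => isBigO_pi.2 fun j => ?_)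
  have h := isBigO_pi.1 (exp_smul_mulVec_isBigO _ hT hb (Pi.single j 1)) i
  refine IsBigO.of_norm_left ((h.norm_left).congr_left fun t => ?_)
  have hmap : (NormedSpace.exp (t • T)).map Complex.ofReal
      = NormedSpace.exp ((t : ℂ) • T.map Complex.ofReal) := by
    have hsmul : (t : ℂ) • T.map Complex.ofReal = (t • T).map Complex.ofReal := by
      ext a b
      simp
    rw [hsmul]
    exact NormedSpace.map_exp (Complex.ofRealHom.mapMatrix (m := Fin p))
      (continuous_id.matrix_map Complex.continuous_ofReal) (t • T)
  rw [← hmap]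
  simp

theorem integral_pow_mul_exp_mul_linearMap_matExp {p : ℕ} (T : Matrix (Fin p) (Fin p) ℝ)
    (hT : ∀ z ∈ spectrum ℂ (T.map Complex.ofReal), z.re < 0) {e : ℝ} (he : 0 < e) (n : ℕ)
    (L : Matrix (Fin p) (Fin p) ℝ →ₗ[ℝ] ℝ) :
    ∫ t in Set.Ioi (0 : ℝ), t ^ n * Real.exp (-(e * t)) * L (matExp (t • T))
      = n.factorial * L ((e • (1 : Matrix (Fin p) (Fin p) ℝ) - T)⁻¹ ^ (n + 1)) := by
  have hO : ∀ b > 0, (fun t : ℝ => NormedSpace.exp (t • T)) =O[atTop]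
      fun t => Real.exp (b * t) :=
    fun b hb => exp_smul_isBigO T (fun z hz => (hT z hz).le) hb
  have hdet : IsUnit (e • (1 : Matrix (Fin p) (Fin p) ℝ) - T).det := by
    have h := pow_mul_integral_pow_mul_exp_smul_exp T hO he 0
    rw [zero_add, pow_one, Nat.factorial_zero, Nat.cast_one, one_smul] at h
    exact (Matrix.isUnit_iff_isUnit_det _).1 (IsUnit.of_mul_eq_one _ h)
  simp only [matExp_eq_exp]
  exact integral_pow_mul_exp_mul_clm_exp T hO he n (Matrix.nonsing_inv_mul _ hdet)
    (LinearMap.toContinuousLinearMap L)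

end MatrixSemigroup

theorem prod_poisson_eq {d : ℕ} (e : Fin d → ℝ) (y : Fin d → ℕ) (θ : ℝ) :
    ∏ i, (θ * e i) ^ (y i) / ((y i).factorial : ℝ) * Real.exp (-(θ * e i))
      = (∏ i, e i ^ y i / ((y i).factorial : ℝ))
        * (θ ^ (∑ i, y i) * Real.exp (-((∑ i, e i) * θ))) := by
  rw [Finset.sum_mul, ← Finset.sum_neg_distrib, Real.exp_sum, ← Finset.prod_pow_eq_pow_sum,
    ← Finset.prod_mul_distrib, ← Finset.prod_mul_distrib]
  refine Finset.prod_congr rfl fun i _ => ?_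
  rw [mul_pow, mul_comm θ (e i)]
  ring

/-- Joint pmf of the bivariate-group mixed Poisson model with
bivariate (feed-forward) phase-type mixing density
`f(θ₁,θ₂) = η e^{T₁₁θ₁} T₁₂ e^{T₂₂θ₂} (−T₂₂)𝟙`:
`∫∫ ∏_{j=1}^2 ∏_i ((θ_j e_{ij})^{y_{ij}}/y_{ij}!) e^{-θ_j e_{ij}} f(θ₁,θ₂) dθ₂ dθ₁
  = (∏_i e_{i1}^{y_{i1}} e_{i2}^{y_{i2}}/(y_{i1}! y_{i2}!)) (y_{•1}! y_{•2}!)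
      η (e_{•1}I − T₁₁)^{-(y_{•1}+1)} T₁₂ (e_{•2}I − T₂₂)^{-(y_{•2}+1)} (−T₂₂)𝟙`. -/
theorem bivariate_phase_type_mixed_poisson_pmf
    (p₁ p₂ : ℕ)
    (T₁₁ : Matrix (Fin p₁) (Fin p₁) ℝ)
    (hT₁₁ : ∀ z ∈ spectrum ℂ (T₁₁.map Complex.ofReal), z.re < 0)
    (T₂₂ : Matrix (Fin p₂) (Fin p₂) ℝ)
    (hT₂₂ : ∀ z ∈ spectrum ℂ (T₂₂.map Complex.ofReal), z.re < 0)
    (T₁₂ : Matrix (Fin p₁) (Fin p₂) ℝ)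
    (η : Fin p₁ → ℝ)
    (d : ℕ) (hd : 0 < d)
    (e₁ e₂ : Fin d → ℝ) (he₁ : ∀ i, 0 < e₁ i) (he₂ : ∀ i, 0 < e₂ i)
    (y₁ y₂ : Fin d → ℕ) :
    (∫ θ₁ in Set.Ioi (0 : ℝ), ∫ θ₂ in Set.Ioi (0 : ℝ),
        (∏ i, (θ₁ * e₁ i) ^ (y₁ i) / ((y₁ i).factorial : ℝ)
            * Real.exp (-(θ₁ * e₁ i)))
          * (∏ i, (θ₂ * e₂ i) ^ (y₂ i) / ((y₂ i).factorial : ℝ)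
              * Real.exp (-(θ₂ * e₂ i)))
          * (η ⬝ᵥ ((matExp (θ₁ • T₁₁) * T₁₂ * matExp (θ₂ • T₂₂) * (-T₂₂))
              *ᵥ (fun _ => (1 : ℝ)))))
      = (∏ i, (e₁ i) ^ (y₁ i) * (e₂ i) ^ (y₂ i)
            / (((y₁ i).factorial : ℝ) * ((y₂ i).factorial : ℝ)))
          * (((∑ i, y₁ i).factorial : ℝ) * ((∑ i, y₂ i).factorial : ℝ))
          * (η ⬝ᵥ
              ((((∑ i, e₁ i) • (1 : Matrix (Fin p₁) (Fin p₁) ℝ) - T₁₁)⁻¹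
                    ^ ((∑ i, y₁ i) + 1)
                  * T₁₂
                  * ((∑ i, e₂ i) • (1 : Matrix (Fin p₂) (Fin p₂) ℝ) - T₂₂)⁻¹
                    ^ ((∑ i, y₂ i) + 1)
                  * (-T₂₂))
                *ᵥ (fun _ => (1 : ℝ)))) := by
  have hsum : ∀ e : Fin d → ℝ, (∀ i, 0 < e i) → 0 < ∑ i, e i := fun e he =>
    Finset.sum_pos (fun i _ => he i) ⟨⟨0, hd⟩, Finset.mem_univ _⟩
  let B : Matrix (Fin p₁) (Fin p₁) ℝ →ₗ[ℝ] Matrix (Fin p₂) (Fin p₂) ℝ →ₗ[ℝ] ℝ :=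
    LinearMap.mk₂ ℝ (fun X Y => η ⬝ᵥ ((X * T₁₂ * Y * (-T₂₂)) *ᵥ (fun _ => (1 : ℝ))))
      (fun X X' Y => by simp only [Matrix.add_mul, Matrix.add_mulVec, dotProduct_add])
      (fun c X Y => by simp only [Matrix.smul_mul, Matrix.smul_mulVec, dotProduct_smul])
      (fun X Y Y' => by
        simp only [Matrix.mul_add, Matrix.add_mul, Matrix.add_mulVec, dotProduct_add])
      (fun c X Y => by
        simp only [Matrix.mul_smul, Matrix.smul_mul, Matrix.smul_mulVec, dotProduct_smul])
  have hB : ∀ X Y, η ⬝ᵥ ((X * T₁₂ * Y * (-T₂₂)) *ᵥ (fun _ => (1 : ℝ))) = B X Y :=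
    fun _ _ => rfl
  simp only [hB, prod_poisson_eq]
  have hinner : ∀ (a c : ℝ) (X : Matrix (Fin p₁) (Fin p₁) ℝ),
      ∫ θ₂ in Set.Ioi (0 : ℝ), a * (c * (θ₂ ^ (∑ i, y₂ i) * Real.exp (-((∑ i, e₂ i) * θ₂))))
          * B X (matExp (θ₂ • T₂₂))
        = a * c * ((∑ i, y₂ i).factorial
          * B X (((∑ i, e₂ i) • (1 : Matrix (Fin p₂) (Fin p₂) ℝ) - T₂₂)⁻¹ ^ ((∑ i, y₂ i) + 1))) := by
    intro a c X
    rw [← integral_pow_mul_exp_mul_linearMap_matExp T₂₂ hT₂₂ (hsum e₂ he₂), ← integral_const_mul]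
    refine integral_congr_ae (Filter.Eventually.of_forall fun t => ?_)
    ring
  simp only [hinner]
  set R := ((∑ i, e₂ i) • (1 : Matrix (Fin p₂) (Fin p₂) ℝ) - T₂₂)⁻¹ ^ ((∑ i, y₂ i) + 1)
  have houter := integral_pow_mul_exp_mul_linearMap_matExp T₁₁ hT₁₁ (hsum e₁ he₁) (∑ i, y₁ i)
    (B.flip R)
  simp only [LinearMap.flip_apply] at houter
  have hcoef : ∏ i, (e₁ i) ^ (y₁ i) * (e₂ i) ^ (y₂ i)
        / (((y₁ i).factorial : ℝ) * ((y₂ i).factorial : ℝ))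
      = (∏ i, e₁ i ^ y₁ i / ((y₁ i).factorial : ℝ))
        * ∏ i, e₂ i ^ y₂ i / ((y₂ i).factorial : ℝ) := by
    rw [← Finset.prod_mul_distrib]
    exact Finset.prod_congr rfl fun i _ => by rw [div_mul_div_comm]
  rw [hcoef]
  have hpull : ∀ t : ℝ,
      (∏ i, e₁ i ^ y₁ i / ((y₁ i).factorial : ℝ))
          * (t ^ (∑ i, y₁ i) * Real.exp (-((∑ i, e₁ i) * t)))
          * (∏ i, e₂ i ^ y₂ i / ((y₂ i).factorial : ℝ))
          * ((∑ i, y₂ i).factorial * B (matExp (t • T₁₁)) R)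
        = (∏ i, e₁ i ^ y₁ i / ((y₁ i).factorial : ℝ))
            * (∏ i, e₂ i ^ y₂ i / ((y₂ i).factorial : ℝ)) * (∑ i, y₂ i).factorial
          * (t ^ (∑ i, y₁ i) * Real.exp (-((∑ i, e₁ i) * t)) * B (matExp (t • T₁₁)) R) :=
    fun t => by ring
  simp only [hpull]
  rw [integral_const_mul, houter]
  ring
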